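/- Let G = HNN_φ(G₁, C, t) be a non-abelian limit group, where G₁ is a finitely generated free group and C ⊆ G₁ is infinite cyclic or trivial. If U is a normal subgroup of G of prime index p, then rk_Q(U) > d(G); in particular d(U) > d(G). -/

import Mathlib

open scoped TensorProduct

/-- A group is fully residually free if every finite subset is mapped injectively
by some homomorphism to a free group. -/
def FullyResiduallyFree (G : Type*) [Group G] : Prop :=
  ∀ T : Finset G, ∃ (α : Type) (f : G →* FreeGroup α), Set.InjOn f T

/-- The rational rank `rk_Q(G) = dim_Q (G^ab ⊗_Z Q)`. -/
noncomputable def rkQ (G : Type*) [Group G] : ℕ :=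
  Module.finrank ℚ (ℚ ⊗[ℤ] Additive (Abelianization G))

/-- The minimal number of generators of a group. -/
noncomputable def d (G : Type*) [Group G] : ℕ :=
  sInf {n | ∃ S : Finset G, S.card = n ∧ Subgroup.closure (S : Set G) = ⊤}


namespace RkAux
open Module

/-- One-cocycles. -/
def Z1 {G M : Type} [Group G] [AddCommGroup M] [Module ℚ M] (ρ : G →* Module.End ℚ M) :
    Submodule ℚ (G → M) where
  carrier := {D | ∀ g h, D (g * h) = D g + ρ g (D h)}
  zero_mem' := by intro g h; simp
  add_mem' := by
    intro a b ha hb g h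
    simp only [Pi.add_apply, ha g h, hb g h, map_add]; abel
  smul_mem' := by
    intro c a ha g h
    simp only [Pi.smul_apply, ha g h, map_smul, smul_add]

/-- Rational homs. -/
abbrev HomQ (G : Type) [Group G] : Submodule ℚ (G → ℚ) := Z1 (1 : G →* Module.End ℚ ℚ)

section
variable {G M : Type} [Group G] [AddCommGroup M] [Module ℚ M] {ρ : G →* Module.End ℚ M}

lemma Z1.mul {D : G → M} (hD : D ∈ Z1 ρ) (g h : G) : D (g * h) = D g + ρ g (D h) := hD g h

lemma Z1.one {D : G → M} (hD : D ∈ Z1 ρ) : D 1 = 0 := by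
  have := hD 1 1
  simpa using this

lemma Z1.inv {D : G → M} (hD : D ∈ Z1 ρ) (g : G) : D g⁻¹ = - ρ g⁻¹ (D g) := by
  have := hD g⁻¹ g
  rw [inv_mul_cancel, Z1.one hD] at this
  exact eq_neg_of_add_eq_zero_left this.symm

lemma HomQ.mul {D : G → ℚ} (hD : D ∈ HomQ G) (g h : G) : D (g * h) = D g + D h := hD g h

lemma HomQ.inv {D : G → ℚ} (hD : D ∈ HomQ G) (g : G) : D g⁻¹ = - D g := by
  rw [Z1.inv hD]; simp

lemma Z1.eq_zero {D : G → M} (hD : D ∈ Z1 ρ) (S : Set G) (hS : Subgroup.closure S = ⊤)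
    (h : ∀ s ∈ S, D s = 0) : D = 0 := by
  funext g
  have hg : g ∈ Subgroup.closure S := by rw [hS]; trivial
  induction hg using Subgroup.closure_induction with
  | mem x hx => exact h x hx
  | one => exact Z1.one hD
  | mul x y _ _ hx hy => rw [hD x y, hx, hy]; simp
  | inv x _ hx => rw [Z1.inv hD, hx]; simp

/-- Evaluation on a family. -/
def ev (ρ : G →* Module.End ℚ M) {ι : Type} (s : ι → G) : Z1 ρ →ₗ[ℚ] (ι → M) where
  toFun D i := D.1 (s i)
  map_add' _ _ := rfl
  map_smul' _ _ := rfl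

lemma ev_inj {ι : Type} (s : ι → G) (hs : Subgroup.closure (Set.range s) = ⊤) :
    Function.Injective (ev ρ s) := by
  rw [← LinearMap.ker_eq_bot, LinearMap.ker_eq_bot']
  intro D h
  apply Subtype.ext
  apply Z1.eq_zero D.2 _ hs
  rintro _ ⟨i, rfl⟩
  exact congrFun h i

variable (ρ) in
lemma finite_Z1 [Group.FG G] [Module.Finite ℚ M] : Module.Finite ℚ (Z1 ρ) := by
  obtain ⟨S, hS⟩ := Group.FG.out (G := G)
  exact Module.Finite.of_injective (ev ρ (fun s : S => (s : G)))
    (ev_inj _ (by simpa using hS))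

/-- Affine group. -/
@[ext] structure Aff (ρ : G →* Module.End ℚ M) where
  m : M
  g : G

instance : Mul (Aff ρ) := ⟨fun a b => ⟨a.m + ρ a.g b.m, a.g * b.g⟩⟩
instance : One (Aff ρ) := ⟨⟨0, 1⟩⟩
instance : Inv (Aff ρ) := ⟨fun a => ⟨- ρ a.g⁻¹ a.m, a.g⁻¹⟩⟩
@[simp] lemma Aff.mul_m (a b : Aff ρ) : (a * b).m = a.m + ρ a.g b.m := rfl
@[simp] lemma Aff.mul_g (a b : Aff ρ) : (a * b).g = a.g * b.g := rfl
@[simp] lemma Aff.one_m : (1 : Aff ρ).m = 0 := rfl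
@[simp] lemma Aff.one_g : (1 : Aff ρ).g = 1 := rfl
@[simp] lemma Aff.inv_m (a : Aff ρ) : (a⁻¹).m = - ρ a.g⁻¹ a.m := rfl
@[simp] lemma Aff.inv_g (a : Aff ρ) : (a⁻¹).g = a.g⁻¹ := rfl

instance : Group (Aff ρ) := Group.ofLeftAxioms
  (by intro a b c; ext <;> simp [add_assoc, mul_assoc])
  (by intro a; ext <;> simp)
  (by intro a; ext <;> simp)

/-- projection -/
def Aff.proj (ρ : G →* Module.End ℚ M) : Aff ρ →* G where
  toFun := Aff.g
  map_one' := rfl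
  map_mul' _ _ := rfl

lemma Z1_of_section (f : G →* Aff ρ) (hf : (Aff.proj ρ).comp f = MonoidHom.id G) :
    (fun g => (f g).m) ∈ Z1 ρ := by
  intro g h
  have : (f g).g = g := DFunLike.congr_fun hf g
  simp [this]

end

lemma free_ext {α M : Type} [AddCommGroup M] [Module ℚ M]
    (ρ : FreeGroup α →* Module.End ℚ M) (v : α → M) :
    ∃ D ∈ Z1 ρ, ∀ a, D (FreeGroup.of a) = v a := by
  let f : FreeGroup α →* Aff ρ := FreeGroup.lift (fun a => ⟨v a, FreeGroup.of a⟩)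
  refine ⟨_, Z1_of_section f ?_, ?_⟩
  · ext a; simp [f, Aff.proj]
  · intro a; simp [f]

lemma ev_free_bij {α M : Type} [AddCommGroup M] [Module ℚ M]
    (ρ : FreeGroup α →* Module.End ℚ M) :
    Function.Bijective (ev ρ (FreeGroup.of : α → FreeGroup α)) := by
  refine ⟨ev_inj _ (FreeGroup.closure_range_of α), fun v => ?_⟩
  obtain ⟨D, hD, h⟩ := free_ext ρ v
  exact ⟨⟨D, hD⟩, funext h⟩

/-- free cocycles -/
noncomputable def freeEquiv {α M : Type} [AddCommGroup M] [Module ℚ M]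
    (ρ : FreeGroup α →* Module.End ℚ M) : Z1 ρ ≃ₗ[ℚ] (α → M) :=
  LinearEquiv.ofBijective _ (ev_free_bij ρ)

lemma finrank_Z1_free {α M : Type} [Fintype α] [AddCommGroup M] [Module ℚ M] [Module.Finite ℚ M]
    (ρ : FreeGroup α →* Module.End ℚ M) :
    finrank ℚ (Z1 ρ) = Fintype.card α * finrank ℚ M := by
  rw [(freeEquiv ρ).finrank_eq, Module.finrank_pi_fintype]; simp

/-- Transport along a group isomorphism. -/
lemma finrank_Z1_of_equiv {G α M : Type} [Group G] [Fintype α] [AddCommGroup M] [Module ℚ M]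
    [Module.Finite ℚ M] (e : FreeGroup α ≃* G) (ρ : G →* Module.End ℚ M) :
    finrank ℚ (Z1 ρ) = Fintype.card α * finrank ℚ M := by
  rw [← finrank_Z1_free (ρ.comp e.toMonoidHom)]
  refine LinearEquiv.finrank_eq
    { toFun := fun D => ⟨fun g => D.1 (e g), fun g h => by simp [Z1.mul D.2]⟩
      invFun := fun D => ⟨fun g => D.1 (e.symm g), fun g h => by simp [Z1.mul D.2]⟩
      map_add' := fun _ _ => rfl
      map_smul' := fun _ _ => rfl
      left_inv := fun D => by ext; simp
      right_inv := fun D => by ext; simp }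

lemma rkQ_eq (G : Type) [Group G] : rkQ G = finrank ℚ (HomQ G) := by
  unfold rkQ
  rw [← Subspace.dual_finrank_eq]
  refine LinearEquiv.finrank_eq ((LinearMap.liftBaseChangeEquiv ℚ).symm.trans
    { toFun := fun l => ⟨fun g => l (Additive.ofMul (Abelianization.of g)), fun g h => by simp⟩
      invFun := fun D => AddMonoidHom.toIntLinearMap
        (MonoidHom.toAdditiveLeft (Abelianization.lift
          { toFun := fun g => Multiplicative.ofAdd (D.1 g)
            map_one' := by rw [Z1.one D.2]; rfl
            map_mul' := fun g h => by rw [HomQ.mul D.2]; rfl }))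
      map_add' := fun _ _ => rfl
      map_smul' := fun _ _ => rfl
      left_inv := fun l => by
        apply LinearMap.ext
        intro x
        obtain ⟨g, hg⟩ := QuotientGroup.mk_surjective x.toMul
        have : x = Additive.ofMul (Abelianization.of g) := by
          rw [← ofMul_toMul x, ← hg]; rfl
        rw [this]
        simp
      right_inv := fun D => by ext; simp })

lemma d_le {G ι : Type} [Group G] [Fintype ι] (s : ι → G)
    (hs : Subgroup.closure (Set.range s) = ⊤) : d G ≤ Fintype.card ι := by
  classical
  refine le_trans (Nat.sInf_le ⟨Finset.univ.image s, rfl, by simpa using hs⟩) ?_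
  exact Finset.card_image_le

lemma rkQ_le_d (G : Type) [Group G] [Group.FG G] : rkQ G ≤ d G := by
  have hne : {n | ∃ S : Finset G, S.card = n ∧ Subgroup.closure (S : Set G) = ⊤}.Nonempty := by
    obtain ⟨S, hS⟩ := Group.FG.out (G := G)
    exact ⟨_, S, rfl, hS⟩
  obtain ⟨S, hc, hS⟩ := Nat.sInf_mem hne
  rw [rkQ_eq]
  have := LinearMap.finrank_le_finrank_of_injective
    (ev_inj (ρ := (1 : G →* Module.End ℚ ℚ)) (fun s : S => (s : G)) (by simpa using hS))
  simp only [finrank_fintype_fun_eq_card, Fintype.card_coe] at this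
  exact this.trans (le_of_eq hc)

/-- The permutation representation. -/
def perm {G : Type} [Group G] (U : Subgroup G) : G →* Module.End ℚ (G ⧸ U → ℚ) where
  toFun g := { toFun := fun m x => m (g⁻¹ • x), map_add' := fun _ _ => rfl,
               map_smul' := fun _ _ => rfl }
  map_one' := by ext; simp
  map_mul' g h := by
    apply LinearMap.ext; intro m; funext x
    simp [mul_smul]

@[simp] lemma perm_apply {G : Type} [Group G] (U : Subgroup G) (g : G) (m : G ⧸ U → ℚ) (x : G ⧸ U) :
    perm U g m x = m (g⁻¹ • x) := rfl

/-- Shapiro plus correction. -/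
noncomputable def shap {G : Type} [Group G] (U : Subgroup G) :
    Z1 (perm U) →ₗ[ℚ] HomQ U × ({x : G ⧸ U // x ≠ ((1 : G) : G ⧸ U)} → ℚ) where
  toFun D := (⟨fun u => D.1 u ((1 : G) : G ⧸ U), fun u v => by
    have : ((u : G)⁻¹ : G) • ((1 : G) : G ⧸ U) = ((1 : G) : G ⧸ U) := by
      rw [MulAction.Quotient.smul_coe, QuotientGroup.eq]
      simp
    simp [Z1.mul D.2, this]⟩, fun x => D.1 x.1.out x.1)
  map_add' _ _ := rfl
  map_smul' _ _ := rfl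

lemma shap_inj {G : Type} [Group G] (U : Subgroup G) : Function.Injective (shap U) := by
  rw [← LinearMap.ker_eq_bot, LinearMap.ker_eq_bot']
  intro D h
  have h1 : ∀ u ∈ U, D.1 u ((1 : G) : G ⧸ U) = 0 := fun u hu =>
    congrFun (congrArg Subtype.val (congrArg Prod.fst h)) ⟨u, hu⟩
  have h2 : ∀ x : G ⧸ U, x ≠ ((1 : G) : G ⧸ U) → D.1 x.out x = 0 := fun x hx =>
    congrFun (congrArg Prod.snd h) ⟨x, hx⟩
  have h3 : ∀ g : G, D.1 g (g : G ⧸ U) = 0 := by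
    intro g
    by_cases hg : (g : G ⧸ U) = ((1 : G) : G ⧸ U)
    · rw [hg]
      apply h1
      have := QuotientGroup.eq.1 hg
      simpa using this
    · have := h2 _ hg
      obtain ⟨u, hu⟩ := QuotientGroup.mk_out_eq_mul U g
      have h4 : D.1 (g * u) (g : G ⧸ U) = 0 := by rw [← hu]; exact this
      rw [Z1.mul D.2] at h4
      have h5 : (g⁻¹ : G) • (g : G ⧸ U) = ((1 : G) : G ⧸ U) := by
        rw [MulAction.Quotient.smul_coe]; simp
      simpa [h5, h1 u u.2] using h4
  apply Subtype.ext
  funext g x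
  obtain ⟨y, rfl⟩ := QuotientGroup.mk_surjective x
  have h4 := h3 (g * (g⁻¹ * y))
  rw [Z1.mul D.2] at h4
  have h5 := h3 (g⁻¹ * y)
  have h6 : (g⁻¹ : G) • (y : G ⧸ U) = ((g⁻¹ * y : G) : G ⧸ U) := by
    rw [MulAction.Quotient.smul_coe]; simp
  simpa [h6, h5] using h4

lemma shap_bound {G : Type} [Group G] [Group.FG G] (U : Subgroup G) (p : ℕ) (hp : p ≠ 0)
    (hU : U.index = p) :
    finrank ℚ (Z1 (perm U)) + 1 ≤ rkQ U + p := by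
  classical
  have : U.FiniteIndex := ⟨by omega⟩
  have : Fintype (G ⧸ U) := Fintype.ofFinite _
  have := finite_Z1 (1 : U →* Module.End ℚ ℚ)
  have h := LinearMap.finrank_le_finrank_of_injective (shap_inj U)
  have hc : Fintype.card (G ⧸ U) = p := by
    rw [← hU, Subgroup.index, Nat.card_eq_fintype_card]
  rw [Module.finrank_prod, finrank_fintype_fun_eq_card, Fintype.card_subtype_compl,
    Fintype.card_subtype_eq, hc, ← rkQ_eq] at h
  omega

section Magnus

/-- Strictly upper triangular filtration. -/
def J {N : ℕ} (n : ℕ) (T : Matrix (Fin N) (Fin N) ℚ) : Prop :=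
  ∀ i j : Fin N, j.1 < i.1 + n → T i j = 0

lemma J.mul {N n m : ℕ} {S T : Matrix (Fin N) (Fin N) ℚ} (hS : J n S) (hT : J m T) :
    J (n + m) (S * T) := by
  intro i j hij
  rw [Matrix.mul_apply]
  apply Finset.sum_eq_zero
  intro k _
  by_cases hk : k.1 < i.1 + n
  · rw [hS i k hk, zero_mul]
  · rw [hT k j (by omega), mul_zero]

lemma J.add {N n : ℕ} {S T : Matrix (Fin N) (Fin N) ℚ} (hS : J n S) (hT : J n T) :
    J n (S + T) := by
  intro i j hij
  rw [Matrix.add_apply, hS i j hij, hT i j hij, add_zero]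

lemma J.mono {N n m : ℕ} {S : Matrix (Fin N) (Fin N) ℚ} (hS : J n S) (h : m ≤ n) : J m S :=
  fun i j hij => hS i j (by omega)

lemma J.one_mul {N n : ℕ} {S T : Matrix (Fin N) (Fin N) ℚ} (hS : J n (S - 1)) (hT : J n (T - 1)) :
    J n (S * T - 1) := by
  have : S * T - 1 = (S - 1) + (T - 1) + (S - 1) * (T - 1) := by noncomm_ring
  rw [this]
  exact (hS.add hT).add ((hS.mul hT).mono (by omega))

/-- Elementary matrix attached to a letter. -/
def X {β : Type} [DecidableEq β] (N : ℕ) (w : ℕ → Option β) (b : β) : Matrix (Fin N) (Fin N) ℚ :=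
  fun i j => if j.1 = i.1 + 1 ∧ w i.1 = some b then 1 else 0

variable {β : Type} [DecidableEq β] {N : ℕ} {w : ℕ → Option β}

lemma X_sq (hw : ∀ i b, w i = some b → w (i + 1) ≠ some b) (b : β) : X N w b * X N w b = 0 := by
  ext i j
  rw [Matrix.mul_apply, Matrix.zero_apply]
  apply Finset.sum_eq_zero
  intro k _
  unfold X
  split_ifs with h1 h2
  · exact absurd (h1.1 ▸ h2.2) (hw _ _ h1.2)
  all_goals simp

lemma X_J (b : β) : J 1 (X N w b) := by
  intro i j hij
  unfold X
  rw [if_neg (by omega)]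

/-- The unit `1 + X_b`. -/
def Xu (hw : ∀ i b, w i = some b → w (i + 1) ≠ some b) (b : β) : (Matrix (Fin N) (Fin N) ℚ)ˣ where
  val := 1 + X N w b
  inv := 1 - X N w b
  val_inv := by
    have := X_sq (N := N) hw b
    have h : (1 + X N w b) * (1 - X N w b) = 1 - X N w b * X N w b := by noncomm_ring
    rw [h, this, sub_zero]
  inv_val := by
    have := X_sq (N := N) hw b
    have h : (1 - X N w b) * (1 + X N w b) = 1 - X N w b * X N w b := by noncomm_ring
    rw [h, this, sub_zero]

lemma Xu_zpow (hw : ∀ i b, w i = some b → w (i + 1) ≠ some b) (b : β) (e : ℤ) :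
    ((Xu (N := N) hw b ^ e : (Matrix (Fin N) (Fin N) ℚ)ˣ) : Matrix (Fin N) (Fin N) ℚ)
      = 1 + (e : ℚ) • X N w b := by
  have h0 := X_sq (N := N) hw b
  induction e using Int.induction_on with
  | zero => simp
  | succ n ih =>
    rw [zpow_add_one, Units.val_mul, ih]
    change _ * (1 + X N w b) = _
    rw [mul_add, mul_one, add_mul, smul_mul_assoc, h0]
    push_cast
    rw [add_smul]; simp [add_assoc]
  | pred n ih =>
    rw [zpow_sub_one, Units.val_mul, ih]
    change _ * (1 - X N w b) = _
    rw [mul_sub, mul_one, add_mul, smul_mul_assoc, h0]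
    push_cast
    rw [sub_smul]; simp [add_sub_assoc]

/-- Magnus-type representation. -/
def mag (hw : ∀ i b, w i = some b → w (i + 1) ≠ some b) :
    FreeGroup β →* (Matrix (Fin N) (Fin N) ℚ)ˣ := FreeGroup.lift (Xu hw)

lemma mag_J (hw : ∀ i b, w i = some b → w (i + 1) ≠ some b) (g : FreeGroup β) :
    J 1 (((mag (N := N) hw g : (Matrix (Fin N) (Fin N) ℚ)ˣ) : Matrix (Fin N) (Fin N) ℚ) - 1) := by
  have h1 : ∀ (b : β) (e : ℤ), J 1 (((mag (N := N) hw (FreeGroup.of b ^ e) :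
      (Matrix (Fin N) (Fin N) ℚ)ˣ) : Matrix (Fin N) (Fin N) ℚ) - 1) := by
    intro b e
    rw [map_zpow, mag, FreeGroup.lift_apply_of, Xu_zpow, add_sub_cancel_left]
    intro i j hij
    rw [Matrix.smul_apply, X_J b i j hij, smul_zero]
  induction g using FreeGroup.induction_on with
  | C1 => intro i j _; simp
  | of b => simpa using h1 b 1
  | inv_of b _ => simpa using h1 b (-1)
  | mul x y hx hy => rw [map_mul, Units.val_mul]; exact hx.one_mul hy

/-- Syllable decomposition. -/
lemma syllables (g : FreeGroup β) : ∃ l : List (β × ℤ), (∀ x ∈ l, x.2 ≠ 0) ∧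
    (l.IsChain fun x y => x.1 ≠ y.1) ∧ (l.map fun x => FreeGroup.of x.1 ^ x.2).prod = g := by
  let F : Monoid.CoprodI (fun _ : β => Multiplicative ℤ) →* FreeGroup β :=
    Monoid.CoprodI.lift (fun b => zpowersHom _ (FreeGroup.of b))
  let F' : FreeGroup β →* Monoid.CoprodI (fun _ : β => Multiplicative ℤ) :=
    FreeGroup.lift (fun b => Monoid.CoprodI.of (i := b) (Multiplicative.ofAdd (1 : ℤ)))
  have hF : F (F' g) = g := by
    have : F.comp F' = MonoidHom.id _ := by ext b; simp [F, F']
    exact DFunLike.congr_fun this g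
  let W := Monoid.CoprodI.Word.equiv (F' g)
  have hW : W.prod = F' g := Monoid.CoprodI.Word.equiv.symm_apply_apply (F' g)
  refine ⟨W.toList.map (fun x => (x.1, Multiplicative.toAdd x.2)), ?_, ?_, ?_⟩
  · intro x hx
    obtain ⟨y, hy, rfl⟩ := List.mem_map.1 hx
    exact W.ne_one y hy
  · rw [List.isChain_map]
    exact W.chain_ne
  · rw [← hF, ← hW, Monoid.CoprodI.Word.prod, map_list_prod, List.map_map, List.map_map]
    congr 1

lemma magnus (g : FreeGroup β) (hg : g ≠ 1) : ∃ (N : ℕ)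
    (θ : FreeGroup β →* (Matrix (Fin N) (Fin N) ℚ)ˣ), θ g ≠ 1 ∧
    ∀ h, J 1 ((θ h : Matrix (Fin N) (Fin N) ℚ) - 1) := by
  obtain ⟨l, h0, hl, rfl⟩ := syllables g
  let w : ℕ → Option β := fun i => (l[i]?).map Prod.fst
  have hw : ∀ i b, w i = some b → w (i + 1) ≠ some b := by
    intro i b h1 h2
    simp only [w, Option.map_eq_some_iff] at h1 h2
    obtain ⟨x, hx, rfl⟩ := h1
    obtain ⟨y, hy, hxy⟩ := h2
    obtain ⟨hi, rfl⟩ := List.getElem?_eq_some_iff.1 hx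
    obtain ⟨hj, rfl⟩ := List.getElem?_eq_some_iff.1 hy
    exact List.isChain_iff_getElem.1 hl i hj hxy.symm
  refine ⟨l.length + 1, mag hw, ?_, mag_J hw⟩
  have key : ∀ k (hk : k ≤ l.length),
      (∀ j : Fin (l.length + 1), k < j.1 →
        ((mag (N := l.length + 1) hw ((l.take k).map fun x => FreeGroup.of x.1 ^ x.2).prod).val 0 j = 0)) ∧
      (mag (N := l.length + 1) hw ((l.take k).map fun x => FreeGroup.of x.1 ^ x.2).prod).val 0
        ⟨k, by omega⟩ ≠ 0 := by
    intro k
    induction k with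
    | zero =>
      intro _
      refine ⟨fun j hj => ?_, by simp⟩
      simp only [List.take_zero, List.map_nil, List.prod_nil, map_one, Units.val_one]
      rw [Matrix.one_apply_ne]
      rintro rfl
      simp at hj
    | succ k ih =>
      intro hk
      obtain ⟨ih1, ih2⟩ := ih (by omega)
      have hk' : k < l.length := by omega
      rw [← List.take_append_getElem hk', List.map_append, List.prod_append, map_mul, Units.val_mul]
      generalize hP : (mag (N := l.length + 1) hw
        ((l.take k).map fun x => FreeGroup.of x.1 ^ x.2).prod).val = P at *
      have h2 : (mag (N := l.length + 1) hw
          ((([l[k]] : List (β × ℤ)).map fun x => FreeGroup.of x.1 ^ x.2).prod)).val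
          = 1 + (l[k].2 : ℚ) • X (l.length + 1) w l[k].1 := by
        simp only [List.map_cons, List.map_nil, List.prod_singleton, map_zpow]
        rw [mag, FreeGroup.lift_apply_of, Xu_zpow]
      rw [h2, mul_add, mul_one, mul_smul_comm]
      have h3 : ∀ j : ℕ, ∀ hj : j + 1 < l.length + 1, (P * X (l.length + 1) w l[k].1) 0 ⟨j + 1, hj⟩
          = P 0 ⟨j, by omega⟩ * (if w j = some l[k].1 then 1 else 0) := by
        intro j hj
        rw [Matrix.mul_apply, Finset.sum_eq_single ⟨j, by omega⟩]
        · simp [X]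
        · intro i _ hi
          have : ¬ (j = i.1) := fun h => hi (Fin.ext h.symm)
          simp [X, this]
        · simp
      constructor
      · rintro ⟨j, hj⟩ hkj
        obtain ⟨j, rfl⟩ : ∃ j', j = j' + 1 := ⟨j - 1, by simp at hkj; omega⟩
        simp only at hkj
        rw [Matrix.add_apply, Matrix.smul_apply, h3, ih1 _ (by simp; omega), ih1 _ (by simp; omega)]
        simp
      · rw [Matrix.add_apply, Matrix.smul_apply, h3, ih1 _ (by simp)]
        have : w k = some l[k].1 := by simp [w, hk']
        rw [if_pos this]
        simp only [mul_one, zero_add, smul_eq_mul]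
        exact mul_ne_zero (by exact_mod_cast h0 _ (List.getElem_mem hk')) ih2
  intro h1
  obtain ⟨_, h2⟩ := key l.length le_rfl
  rw [List.take_length, h1] at h2
  have hl0 : l.length ≠ 0 := by
    intro h
    apply hg
    rw [List.length_eq_zero_iff.1 h]; rfl
  apply h2
  rw [Units.val_one, Matrix.one_apply_ne]
  intro h
  exact hl0 (congrArg Fin.val h).symm

end Magnus

/-- Stallings-type argument. -/
lemma stallings {G ι : Type} [Group G] (hG : FullyResiduallyFree G)
    (f : G →* FreeGroup ι) (hf : Function.Surjective f)
    (hH : ∀ χ ∈ HomQ G, ∀ k, f k = 1 → χ k = 0) : Function.Injective f := by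
  classical
  rw [injective_iff_map_eq_one]
  intro k0 hk0
  by_contra hne
  obtain ⟨β, h, hinj⟩ := hG {k0, 1}
  have hk1 : h k0 ≠ 1 := by
    intro h1
    apply hne
    apply hinj (by simp) (by simp)
    rw [h1, map_one]
  obtain ⟨N, θ, hθ, hJ⟩ := magnus (h k0) hk1
  choose s hs using hf
  let σ : FreeGroup ι →* G := FreeGroup.lift (fun i => s (FreeGroup.of i))
  have hσ : ∀ x, f (σ x) = x := by
    intro x
    have : f.comp σ = MonoidHom.id _ := by ext i; simp [σ, hs]
    exact DFunLike.congr_fun this x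
  -- invariant homs vanish
  have inv_hom : ∀ lam : G → ℚ, (∀ k k', f k = 1 → f k' = 1 → lam (k * k') = lam k + lam k') →
      (∀ g k, f k = 1 → lam (g * k * g⁻¹) = lam k) → ∀ k, f k = 1 → lam k = 0 := by
    intro lam h1 h2 k hk
    have h3 : (fun g => lam (g * (σ (f g))⁻¹)) ∈ HomQ G := by
      intro a b
      have e : a * b * (σ (f (a * b)))⁻¹ =
          (a * (σ (f a))⁻¹) * (σ (f a) * (b * (σ (f b))⁻¹) * (σ (f a))⁻¹) := by
        rw [map_mul, map_mul]; group
      simp only [MonoidHom.one_apply, Module.End.one_apply]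
      rw [e, h1 _ _ (by simp [hσ]) (by simp [hσ]), h2 _ _ (by simp [hσ])]
    have h4 := hH _ h3 k hk
    simpa [hk] using h4
  have key : ∀ n, ∀ k, f k = 1 → J (n + 1) ((θ (h k) : Matrix (Fin N) (Fin N) ℚ) - 1) := by
    intro n
    induction n with
    | zero => intro k _; exact hJ _
    | succ n ih =>
      intro k hk i j hij
      by_cases hij' : j.1 < i.1 + (n + 1)
      · exact ih k hk i j hij'
      refine inv_hom (fun k => ((θ (h k) : Matrix (Fin N) (Fin N) ℚ) - 1) i j) ?_ ?_ k hk
      · intro a b ha hb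
        have e : ((θ (h (a * b)) : Matrix (Fin N) (Fin N) ℚ) - 1) =
            ((θ (h a) : Matrix (Fin N) (Fin N) ℚ) - 1) + ((θ (h b) : Matrix (Fin N) (Fin N) ℚ) - 1)
            + ((θ (h a) : Matrix (Fin N) (Fin N) ℚ) - 1) * ((θ (h b) : Matrix (Fin N) (Fin N) ℚ) - 1) := by
          rw [map_mul, map_mul, Units.val_mul]; noncomm_ring
        have z := ((ih a ha).mul (ih b hb)) i j (by omega)
        change ((θ (h (a * b)) : Matrix (Fin N) (Fin N) ℚ) - 1) i j = _
        rw [e, Matrix.add_apply, Matrix.add_apply, z, add_zero]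
      · intro g a ha
        have e : ((θ (h (g * a * g⁻¹)) : Matrix (Fin N) (Fin N) ℚ) - 1) +
            ((θ (h (g * a * g⁻¹)) : Matrix (Fin N) (Fin N) ℚ) - 1) *
              ((θ (h g) : Matrix (Fin N) (Fin N) ℚ) - 1) =
            ((θ (h a) : Matrix (Fin N) (Fin N) ℚ) - 1) +
            ((θ (h g) : Matrix (Fin N) (Fin N) ℚ) - 1) *
              ((θ (h a) : Matrix (Fin N) (Fin N) ℚ) - 1) := by
          have e1 : (θ (h (g * a * g⁻¹)) : Matrix (Fin N) (Fin N) ℚ) * θ (h g) = θ (h g) * θ (h a) := by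
            rw [← Units.val_mul, ← map_mul, ← map_mul, ← Units.val_mul, ← map_mul, ← map_mul]
            simp
          have e2 : ∀ P Q R : Matrix (Fin N) (Fin N) ℚ, P * Q = Q * R →
              (P - 1) + (P - 1) * (Q - 1) = (R - 1) + (Q - 1) * (R - 1) := by
            intro P Q R h
            have l1 : (P - 1) + (P - 1) * (Q - 1) = P * Q - Q := by noncomm_ring
            have l2 : (R - 1) + (Q - 1) * (R - 1) = Q * R - Q := by noncomm_ring
            rw [l1, l2, h]
          exact e2 _ _ _ e1
        have z1 := ((ih (g * a * g⁻¹) (by simp [ha])).mul (hJ (h g))) i j (by omega)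
        have z2 := ((hJ (h g)).mul (ih a ha)) i j (by omega)
        have e3 := congrFun (congrFun e i) j
        rw [Matrix.add_apply, Matrix.add_apply, z1, z2, add_zero, add_zero] at e3
        exact e3
  apply hθ
  apply Units.ext
  rw [Units.val_one, ← sub_eq_zero]
  ext i j
  exact key N k0 hk0 i j (by omega)

lemma free_of_rank_two {G : Type} [Group G] [Group.FG G] (hG : FullyResiduallyFree G)
    (hna : ¬ ∀ a b : G, a * b = b * a) (hd : finrank ℚ (HomQ G) ≤ 2) :
    ∃ (ι : Type) (_ : Fintype ι), Fintype.card ι = 2 ∧ Nonempty (FreeGroup ι ≃* G) := by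
  classical
  push Not at hna
  obtain ⟨a, b, hab⟩ := hna
  obtain ⟨α, f0, hinj⟩ := hG {a * b, b * a}
  have hab0 : f0 a * f0 b ≠ f0 b * f0 a := by
    intro h
    apply hab
    apply hinj (by simp) (by simp)
    simpa using h
  let e := IsFreeGroup.toFreeGroup f0.range
  let ι := IsFreeGroup.Generators f0.range
  let f : G →* FreeGroup ι := e.toMonoidHom.comp f0.rangeRestrict
  have hf : Function.Surjective f := e.surjective.comp f0.rangeRestrict_surjective
  have hfab : f a * f b ≠ f b * f a := by
    intro h
    rw [← map_mul, ← map_mul] at h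
    have := congrArg Subtype.val (e.injective h)
    simp at this
    exact hab0 this
  have : Module.Finite ℚ (HomQ G) := finite_Z1 _
  -- pullback
  let P : HomQ (FreeGroup ι) →ₗ[ℚ] HomQ G :=
    { toFun := fun χ => ⟨fun g => χ.1 (f g), fun g h => by simp [HomQ.mul χ.2]⟩
      map_add' := fun _ _ => rfl
      map_smul' := fun _ _ => rfl }
  have hP : Function.Injective P := by
    intro χ χ' h
    apply Subtype.ext
    funext x
    obtain ⟨g, rfl⟩ := hf x
    exact congrFun (congrArg Subtype.val h) g
  have fin1 : Module.Finite ℚ (HomQ (FreeGroup ι)) := Module.Finite.of_injective P hP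
  have fin2 : Module.Finite ℚ (ι → ℚ) := Module.Finite.equiv
    (freeEquiv (1 : FreeGroup ι →* Module.End ℚ ℚ))
  have fin3 : Finite ι := by
    by_contra hinf
    rw [not_finite_iff_infinite] at hinf
    have li : LinearIndependent ℚ (fun i : ι => (Pi.single i 1 : ι → ℚ)) :=
      Pi.linearIndependent_single_one ι ℚ
    exact not_finite_iff_infinite.2 hinf li.finite
  have : Fintype ι := Fintype.ofFinite ι
  have hfr : finrank ℚ (HomQ (FreeGroup ι)) = Fintype.card ι := by
    rw [finrank_Z1_free]; simp
  have hle := LinearMap.finrank_le_finrank_of_injective hP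
  have hge : 2 ≤ Fintype.card ι := by
    by_contra hlt
    have hsub : Subsingleton ι := Fintype.card_le_one_iff_subsingleton.1 (by omega)
    apply hfab
    rcases isEmpty_or_nonempty ι with he | ⟨⟨i⟩⟩
    · exact Subsingleton.elim _ _
    · have hz : ∀ x : FreeGroup ι, x ∈ Subgroup.zpowers (FreeGroup.of i) := by
        intro x
        have hx : x ∈ Subgroup.closure (Set.range (FreeGroup.of : ι → FreeGroup ι)) := by
          rw [FreeGroup.closure_range_of]; trivial
        refine (Subgroup.closure_le _).2 ?_ hx
        rintro _ ⟨j, rfl⟩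
        rw [Subsingleton.elim j i]
        exact Subgroup.mem_zpowers _
      obtain ⟨m, hm⟩ := hz (f a)
      obtain ⟨n, hn⟩ := hz (f b)
      simp only at hm hn
      rw [← hm, ← hn, ← zpow_add, ← zpow_add, add_comm]
  have hsurj : Function.Surjective P :=
    (LinearMap.injective_iff_surjective_of_finrank_eq_finrank (by omega)).1 hP
  have hinj' : Function.Injective f := by
    refine stallings hG f hf ?_
    intro χ hχ k hk
    obtain ⟨ψ, hψ⟩ := hsurj ⟨χ, hχ⟩
    have : χ k = ψ.1 (f k) := (congrFun (congrArg Subtype.val hψ) k).symm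
    rw [this, hk, Z1.one ψ.2]
  exact ⟨ι, ‹_›, by omega, ⟨(MulEquiv.ofBijective f ⟨hinj', hf⟩).symm⟩⟩

section HNN
open HNNExtension
variable {r : ℕ} {A B : Subgroup (FreeGroup (Fin r))} {φ : A ≃* B}

/-- generators -/
def gens (φ : A ≃* B) : Option (Fin r) → HNNExtension (FreeGroup (Fin r)) A B φ
  | none => t
  | some i => of (FreeGroup.of i)

lemma gens_top : Subgroup.closure (Set.range (gens φ)) = ⊤ := by
  rw [eq_top_iff]
  intro x _
  induction x using HNNExtension.induction_on with
  | of g =>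
    induction g using FreeGroup.induction_on with
    | C1 => rw [map_one]; exact one_mem _
    | of i => exact Subgroup.subset_closure ⟨some i, rfl⟩
    | inv_of i h => rw [map_inv]; exact inv_mem (h trivial)
    | mul x y hx hy => rw [map_mul]; exact mul_mem (hx trivial) (hy trivial)
  | t => exact Subgroup.subset_closure ⟨none, rfl⟩
  | mul x y hx hy => exact mul_mem (hx trivial) (hy trivial)
  | inv x hx => exact inv_mem (hx trivial)

instance : Group.FG (HNNExtension (FreeGroup (Fin r)) A B φ) := by
  classical
  exact ⟨⟨Finset.univ.image (gens φ), by simpa using gens_top⟩⟩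

lemma d_hnn_le : d (HNNExtension (FreeGroup (Fin r)) A B φ) ≤ r + 1 := by
  simpa using d_le (gens φ) gens_top

variable {M : Type} [AddCommGroup M] [Module ℚ M]

/-- restriction to base group and stable letter -/
def res (ρ : HNNExtension (FreeGroup (Fin r)) A B φ →* Module.End ℚ M) :
    Z1 ρ →ₗ[ℚ] Z1 (ρ.comp of) × M where
  toFun D := (⟨fun g => D.1 (of g), fun g h => by simp [Z1.mul D.2]⟩, D.1 t)
  map_add' _ _ := rfl
  map_smul' _ _ := rfl

lemma res_inj (ρ : HNNExtension (FreeGroup (Fin r)) A B φ →* Module.End ℚ M) :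
    Function.Injective (res ρ) := by
  rw [← LinearMap.ker_eq_bot, LinearMap.ker_eq_bot']
  intro D h
  apply Subtype.ext
  apply Z1.eq_zero D.2 _ gens_top
  rintro _ ⟨i, rfl⟩
  cases i with
  | none => exact congrArg Prod.snd h
  | some i => exact congrFun (congrArg Subtype.val (congrArg Prod.fst h)) (FreeGroup.of i)

/-- relator equation -/
def relE (ρ : HNNExtension (FreeGroup (Fin r)) A B φ →* Module.End ℚ M) (c : A) :
    Z1 (ρ.comp of) × M →ₗ[ℚ] M where
  toFun x := x.2 + ρ t (x.1.1 c) - (x.1.1 (φ c) + ρ (of (φ c : FreeGroup (Fin r))) x.2)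
  map_add' x y := by simp; abel
  map_smul' a x := by simp [smul_sub]

lemma relE_res (ρ : HNNExtension (FreeGroup (Fin r)) A B φ →* Module.End ℚ M) (c : A) (D : Z1 ρ) :
    relE ρ c (res ρ D) = 0 := by
  have h := congrArg D.1 (t_mul_of (φ := φ) c)
  rw [Z1.mul D.2, Z1.mul D.2] at h
  change D.1 t + ρ t (D.1 (of (c : FreeGroup (Fin r)))) - (D.1 (of (φ c : FreeGroup (Fin r))) +
    ρ (of (φ c : FreeGroup (Fin r))) (D.1 t)) = 0
  rw [h, sub_self]

lemma hnn_ext (ρ : HNNExtension (FreeGroup (Fin r)) A B φ →* Module.End ℚ M) (c : A)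
    (hc : ∀ a : A, a ∈ Subgroup.zpowers c) :
    LinearMap.ker (relE ρ c) ≤ LinearMap.range (res ρ) := by
  rintro ⟨D0, m⟩ h
  rw [LinearMap.mem_ker] at h
  have h' : m + ρ t (D0.1 c) = D0.1 (φ c) + ρ (of (φ c : FreeGroup (Fin r))) m := sub_eq_zero.1 h
  let f0 : FreeGroup (Fin r) →* Aff ρ :=
    { toFun := fun g => ⟨D0.1 g, of g⟩
      map_one' := by ext <;> simp [Z1.one D0.2]
      map_mul' := fun g h => by ext <;> simp [Z1.mul D0.2] }
  let T : Aff ρ := ⟨m, t⟩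
  have hT : ∀ a : A, T * f0 a = f0 (φ a : FreeGroup (Fin r)) * T := by
    have hc0 : T * f0 c = f0 (φ c : FreeGroup (Fin r)) * T := by
      ext
      · simpa [T, f0] using h'
      · simpa [T, f0] using t_mul_of (φ := φ) c
    have hc1 : f0 (φ c : FreeGroup (Fin r)) = T * f0 c * T⁻¹ := by rw [hc0]; group
    intro a
    obtain ⟨n, rfl⟩ := hc a
    have e1 : f0 (φ (c ^ n) : FreeGroup (Fin r)) = (T * f0 c * T⁻¹) ^ n := by
      rw [← hc1]; simp
    simp only
    rw [e1, conj_zpow]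
    simp
  let f := HNNExtension.lift f0 T hT
  have hf : (Aff.proj ρ).comp f = MonoidHom.id _ := by
    refine HNNExtension.hom_ext ?_ ?_
    · apply MonoidHom.ext; intro g; simp [f, f0, Aff.proj]
    · simp [f, T, Aff.proj]
  refine ⟨⟨_, Z1_of_section f hf⟩, ?_⟩
  refine Prod.ext (Subtype.ext ?_) ?_
  · funext g; simp [res, f, f0]
  · simp [res, f, T]

lemma hnn_bound [Module.Finite ℚ M]
    (ρ : HNNExtension (FreeGroup (Fin r)) A B φ →* Module.End ℚ M) (c : A)
    (hc : ∀ a : A, a ∈ Subgroup.zpowers c) :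
    (r + 1) * finrank ℚ M ≤ finrank ℚ (Z1 ρ) + finrank ℚ (LinearMap.range (relE ρ c)) := by
  have := finite_Z1 ρ
  have := finite_Z1 (ρ.comp of)
  have h1 := LinearMap.finrank_range_add_finrank_ker (relE ρ c)
  rw [Module.finrank_prod, finrank_Z1_free, Fintype.card_fin] at h1
  have h2 := Submodule.finrank_mono (hnn_ext ρ c hc)
  rw [LinearMap.finrank_range_of_inj (res_inj ρ)] at h2
  rw [add_mul, one_mul]
  omega

lemma homQ_le : finrank ℚ (HomQ (HNNExtension (FreeGroup (Fin r)) A B φ)) ≤ r + 1 := by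
  have h := LinearMap.finrank_le_finrank_of_injective
    (ev_inj (ρ := (1 : HNNExtension (FreeGroup (Fin r)) A B φ →* Module.End ℚ ℚ)) (gens φ) gens_top)
  rw [finrank_fintype_fun_eq_card] at h
  simpa using h

lemma homQ_le' (c : A) (χ : FreeGroup (Fin r) → ℚ) (hχ : χ ∈ HomQ (FreeGroup (Fin r)))
    (hne : χ c ≠ χ (φ c)) :
    finrank ℚ (HomQ (HNNExtension (FreeGroup (Fin r)) A B φ)) ≤ r := by
  let ρ : HNNExtension (FreeGroup (Fin r)) A B φ →* Module.End ℚ ℚ := 1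
  have := finite_Z1 ρ
  have := finite_Z1 (ρ.comp of)
  have h1 := LinearMap.finrank_range_add_finrank_ker (relE ρ c)
  rw [Module.finrank_prod, finrank_Z1_free, Fintype.card_fin, finrank_self] at h1
  have h2 : LinearMap.range (res ρ) ≤ LinearMap.ker (relE ρ c) := by
    rintro _ ⟨D, rfl⟩
    exact relE_res ρ c D
  have h3 := Submodule.finrank_mono h2
  rw [LinearMap.finrank_range_of_inj (res_inj ρ)] at h3
  have h4 : 0 < finrank ℚ (LinearMap.range (relE ρ c)) := by
    rw [Module.finrank_pos_iff_exists_ne_zero]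
    refine ⟨⟨_, ⟨(⟨χ, hχ⟩, 0), rfl⟩⟩, ?_⟩
    intro h
    apply hne
    have h := congrArg Subtype.val h
    simpa [relE, ρ, sub_eq_zero] using h
  change finrank ℚ (Z1 ρ) ≤ r
  omega

/-- If the abelianized relator is trivial, the image of the relator map is small. -/
lemma range_relE_small (U : Subgroup (HNNExtension (FreeGroup (Fin r)) A B φ)) (p : ℕ)
    [Fintype (HNNExtension (FreeGroup (Fin r)) A B φ ⧸ U)]
    (hU : Fintype.card (HNNExtension (FreeGroup (Fin r)) A B φ ⧸ U) = p) (c : A)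
    (h : ∀ χ ∈ HomQ (FreeGroup (Fin r)), χ c = χ (φ c)) :
    finrank ℚ (LinearMap.range (relE (perm U) c)) + 1 ≤ p := by
  let Sm : (HNNExtension (FreeGroup (Fin r)) A B φ ⧸ U → ℚ) →ₗ[ℚ] ℚ :=
    { toFun := fun m => ∑ x, m x
      map_add' := fun a b => by simp [Finset.sum_add_distrib]
      map_smul' := fun a b => by simp [Finset.mul_sum] }
  have hinv : ∀ g m, Sm (perm U g m) = Sm m := by
    intro g m
    change ∑ x, m (g⁻¹ • x) = ∑ x, m x
    exact Equiv.sum_comp (MulAction.toPerm g⁻¹) m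
  have hle : LinearMap.range (relE (perm U) c) ≤ LinearMap.ker Sm := by
    rintro _ ⟨⟨D, m⟩, rfl⟩
    have h1 := h (fun g => Sm (D.1 g)) (fun a b => by
      have := Z1.mul D.2 a b
      simp only [this, map_add, MonoidHom.comp_apply, hinv]
      simp)
    rw [LinearMap.mem_ker]
    simp only [relE, LinearMap.coe_mk, AddHom.coe_mk, map_sub, map_add, hinv]
    rw [h1]; ring
  have h2 := Submodule.finrank_mono hle
  have h3 := LinearMap.finrank_range_add_finrank_ker Sm
  rw [finrank_fintype_fun_eq_card, hU] at h3
  have h4 : 0 < finrank ℚ (LinearMap.range Sm) := by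
    rw [Module.finrank_pos_iff_exists_ne_zero]
    refine ⟨⟨_, ⟨fun _ => 1, rfl⟩⟩, ?_⟩
    intro h
    have h := congrArg Subtype.val h
    simp [Sm] at h
  omega

lemma main (p : ℕ) (hp : p.Prime)
    (hA : ∃ c : FreeGroup (Fin r), A = Subgroup.zpowers c)
    (hlim : FullyResiduallyFree (HNNExtension (FreeGroup (Fin r)) A B φ))
    (hna : ¬ ∀ a b : HNNExtension (FreeGroup (Fin r)) A B φ, a * b = b * a)
    (U : Subgroup (HNNExtension (FreeGroup (Fin r)) A B φ))
    (hU : U.index = p) :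
    d (HNNExtension (FreeGroup (Fin r)) A B φ) < rkQ ↥U := by
  have hp2 := hp.two_le
  have hs := shap_bound U p (by omega) hU
  by_cases h2 : finrank ℚ (HomQ (HNNExtension (FreeGroup (Fin r)) A B φ)) ≤ 2
  · obtain ⟨ι, _, hι, ⟨e⟩⟩ := free_of_rank_two hlim hna h2
    have : U.FiniteIndex := ⟨by omega⟩
    have : Fintype (HNNExtension (FreeGroup (Fin r)) A B φ ⧸ U) := Fintype.ofFinite _
    have hc : Fintype.card (HNNExtension (FreeGroup (Fin r)) A B φ ⧸ U) = p := by
      rw [← hU, Subgroup.index, Nat.card_eq_fintype_card]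
    rw [finrank_Z1_of_equiv e, finrank_fintype_fun_eq_card, hc, hι] at hs
    have hd := d_le (fun i => e (FreeGroup.of i)) (by
      have : Set.range (fun i => e (FreeGroup.of i)) =
          e.toMonoidHom '' Set.range (FreeGroup.of : ι → FreeGroup ι) := by
        rw [← Set.range_comp]; rfl
      rw [this, ← MonoidHom.map_closure, FreeGroup.closure_range_of, ← MonoidHom.range_eq_map,
        MonoidHom.range_eq_top]
      exact e.surjective)
    omega
  · obtain ⟨c0, hA0⟩ := hA
    have hr : 2 ≤ r := by
      have := homQ_le (φ := φ)
      omega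
    have : U.FiniteIndex := ⟨by omega⟩
    have : Fintype (HNNExtension (FreeGroup (Fin r)) A B φ ⧸ U) := Fintype.ofFinite _
    have hcard : Fintype.card (HNNExtension (FreeGroup (Fin r)) A B φ ⧸ U) = p := by
      rw [← hU, Subgroup.index, Nat.card_eq_fintype_card]
    let c : A := ⟨c0, by rw [hA0]; exact Subgroup.mem_zpowers _⟩
    have hc : ∀ a : A, a ∈ Subgroup.zpowers c := by
      rintro ⟨a, ha⟩
      have ha' := ha
      rw [hA0] at ha'
      obtain ⟨n, hn⟩ := ha'
      exact ⟨n, Subtype.ext (by simpa [c] using hn)⟩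
    have hb := hnn_bound (perm U) c hc
    rw [finrank_fintype_fun_eq_card, hcard] at hb
    have hd := d_hnn_le (φ := φ)
    have hE : finrank ℚ (LinearMap.range (relE (perm U) c)) ≤ p := by
      refine (Submodule.finrank_le _).trans ?_
      rw [finrank_fintype_fun_eq_card, hcard]
    obtain ⟨k, rfl⟩ : ∃ k, r = k + 2 := ⟨r - 2, by omega⟩
    have hk : k * 2 ≤ k * p := Nat.mul_le_mul_left k hp2
    have hexp : (k + 2 + 1) * p = k * p + 3 * p := by ring
    by_cases hk0 : k = 0
    · have hall : ∀ χ ∈ HomQ (FreeGroup (Fin (k + 2))), χ c = χ (φ c) := by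
        intro χ hχ
        by_contra hne
        have := homQ_le' c χ hχ hne
        omega
      have := range_relE_small U p hcard c hall
      omega
    · omega

end HNN

end RkAux

theorem rkQ_gt_d_hnn_free (r p : ℕ) (hp : p.Prime)
    (A B : Subgroup (FreeGroup (Fin r))) (φ : A ≃* B)
    (hA : A = ⊥ ∨ ∃ c : FreeGroup (Fin r), ¬ IsOfFinOrder c ∧ A = Subgroup.zpowers c)
    (hlim : FullyResiduallyFree (HNNExtension (FreeGroup (Fin r)) A B φ))
    (hna : ¬ ∀ a b : HNNExtension (FreeGroup (Fin r)) A B φ, a * b = b * a)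
    (U : Subgroup (HNNExtension (FreeGroup (Fin r)) A B φ)) [U.Normal]
    (hU : U.index = p) :
    d (HNNExtension (FreeGroup (Fin r)) A B φ) < rkQ ↥U ∧
      d (HNNExtension (FreeGroup (Fin r)) A B φ) < d ↥U := by 
  have h1 : d (HNNExtension (FreeGroup (Fin r)) A B φ) < rkQ ↥U := by
    refine RkAux.main p hp ?_ hlim hna U hU
    rcases hA with rfl | ⟨c, -, rfl⟩
    · exact ⟨1, by simp⟩
    · exact ⟨c, rfl⟩
  have : U.FiniteIndex := ⟨by rw [hU]; exact hp.ne_zero⟩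
  exact ⟨h1, lt_of_lt_of_le h1 (RkAux.rkQ_le_d _)⟩
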